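/- arXiv:1503.01141 — 2 statements merged into one kernel-verified Lean document; each statement's English description precedes it below -/
import Mathlib

section
/- Let r > 0, let q = e^{−π√r}, and let k ∈ (0,1) satisfy K(√(1−k²)) = √r · K(k). Then ∑_{n∈ℤ} (−1)^n q^{2n² + 3n/2} = q^{−11/96} · η(q⁴) · (4(1−k)⁴(2 + k − 2√(1+k))^{12} / (k^{13}(1+k)²))^{1/48}. -/
open Real

/-- Complete elliptic integral of the first kind. -/
noncomputable def ellK (x : ℝ) : ℝ :=
  ∫ θ in (0:ℝ)..(π/2), (1 - x ^ 2 * Real.sin θ ^ 2) ^ (-(1:ℝ)/2)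

/-- The eta product `η(q) = ∏_{n≥1} (1 - q^n)` (real powers). -/
noncomputable def etaP (q : ℝ) : ℝ := ∏' n : ℕ, (1 - q ^ ((n : ℝ) + 1))

/-- `A(a,p;q) = q^{p/12 - a/2 + a²/(2p)} ∏_{n≥1} (1 - q^{np+a})(1 - q^{np+p-a})`. -/
noncomputable def Afun (a p q : ℝ) : ℝ :=
  q ^ (p / 12 - a / 2 + a ^ 2 / (2 * p)) *
    ∏' n : ℕ, ((1 - q ^ (((n : ℝ) + 1) * p + a)) * (1 - q ^ (((n : ℝ) + 1) * p + p - a)))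

/-- `∑ exp(-w (n + c)²)` over the integers. -/
noncomputable def thetaP (w c : ℝ) : ℝ := ∑' n : ℤ, exp (-w * ((n : ℝ) + c) ^ 2)

/-- `∑ (-1)ⁿ exp(-w (n + c)²)` over the integers. -/
noncomputable def thetaM (w c : ℝ) : ℝ := ∑' n : ℤ, (-1 : ℝ) ^ n * exp (-w * ((n : ℝ) + c) ^ 2)

lemma summable_thetaP {w : ℝ} (hw : 0 < w) (c : ℝ) :
    Summable fun n : ℤ => exp (-w * ((n : ℝ) + c) ^ 2) := by
  refine (HurwitzKernelBounds.summable_f_int 0 c (div_pos hw pi_pos)).congr fun n => ?_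
  rw [HurwitzKernelBounds.f_int, pow_zero, one_mul]
  congr 1
  field_simp

lemma summable_thetaM {w : ℝ} (hw : 0 < w) (c : ℝ) :
    Summable fun n : ℤ => (-1 : ℝ) ^ n * exp (-w * ((n : ℝ) + c) ^ 2) := by
  refine Summable.of_norm ((summable_thetaP hw c).congr fun n => ?_)
  simp

/-- Pairs of integers, split by the parity of their sum. -/
def parityEquiv : (ℤ × ℤ) ⊕ (ℤ × ℤ) ≃ ℤ × ℤ where
  toFun := Sum.elim (fun p => (p.1 + p.2, p.1 - p.2)) (fun p => (p.1 + p.2 + 1, p.1 - p.2))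
  invFun p := if (p.1 + p.2) % 2 = 0 then .inl ((p.1 + p.2) / 2, (p.1 - p.2) / 2)
    else .inr ((p.1 + p.2 - 1) / 2, (p.1 - p.2 - 1) / 2)
  left_inv := by
    rintro (⟨i, j⟩ | ⟨i, j⟩)
    · have h : (i + j + (i - j)) % 2 = 0 := by omega
      simp only [Sum.elim_inl, h, if_true, Sum.inl.injEq, Prod.mk.injEq]
      omega
    · have h : ¬ (i + j + 1 + (i - j)) % 2 = 0 := by omega
      simp only [Sum.elim_inr, h, if_false, Sum.inr.injEq, Prod.mk.injEq]
      omega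
  right_inv := by
    rintro ⟨i, j⟩
    by_cases h : (i + j) % 2 = 0
    · simp only [h, if_true, Sum.elim_inl, Prod.mk.injEq]
      omega
    · simp only [h, if_false, Sum.elim_inr, Prod.mk.injEq]
      omega

lemma tsum_mul_tsum_parity {f g f₁ g₁ f₂ g₂ : ℤ → ℝ} (hf : Summable f) (hg : Summable g)
    (hf₁ : Summable f₁) (hg₁ : Summable g₁) (hf₂ : Summable f₂) (hg₂ : Summable g₂)
    (h₁ : ∀ i j, f (i + j) * g (i - j) = f₁ i * g₁ j)
    (h₂ : ∀ i j, f (i + j + 1) * g (i - j) = f₂ i * g₂ j) :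
    (∑' n, f n) * ∑' n, g n = (∑' n, f₁ n) * (∑' n, g₁ n) + (∑' n, f₂ n) * ∑' n, g₂ n := by
  rw [tsum_mul_tsum_of_summable_norm hf.norm hg.norm,
    tsum_mul_tsum_of_summable_norm hf₁.norm hg₁.norm,
    tsum_mul_tsum_of_summable_norm hf₂.norm hg₂.norm, ← parityEquiv.tsum_eq]
  have s₁ := summable_mul_of_summable_norm hf₁.norm hg₁.norm
  have s₂ := summable_mul_of_summable_norm hf₂.norm hg₂.norm
  rw [Summable.tsum_sum]
  · congr 1
    · exact tsum_congr fun p => h₁ p.1 p.2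
    · exact tsum_congr fun p => h₂ p.1 p.2
  · exact s₁.congr fun p => (h₁ p.1 p.2).symm
  · exact s₂.congr fun p => (h₂ p.1 p.2).symm

lemma thetaP_mul_thetaP {w : ℝ} (hw : 0 < w) (a b : ℝ) :
    thetaP w a * thetaP w b = thetaP (2 * w) ((a + b) / 2) * thetaP (2 * w) ((a - b) / 2) +
      thetaP (2 * w) ((a + b + 1) / 2) * thetaP (2 * w) ((a - b + 1) / 2) := by
  have hw2 : 0 < 2 * w := by linarith
  refine tsum_mul_tsum_parity (summable_thetaP hw _) (summable_thetaP hw _)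
    (summable_thetaP hw2 _) (summable_thetaP hw2 _) (summable_thetaP hw2 _)
    (summable_thetaP hw2 _) (fun i j => ?_) (fun i j => ?_) <;>
  · rw [← exp_add, ← exp_add]
    congr 1
    push_cast
    ring

lemma thetaM_mul_thetaM {w : ℝ} (hw : 0 < w) (a b : ℝ) :
    thetaM w a * thetaM w b = thetaP (2 * w) ((a + b) / 2) * thetaP (2 * w) ((a - b) / 2) -
      thetaP (2 * w) ((a + b + 1) / 2) * thetaP (2 * w) ((a - b + 1) / 2) := by
  have hw2 : 0 < 2 * w := by linarith
  have h1 (i j : ℤ) : (-1 : ℝ) ^ (i + j) * (-1 : ℝ) ^ (i - j) = 1 := by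
    rw [← zpow_add₀ (by norm_num)]
    exact Even.neg_one_zpow ⟨i, by ring⟩
  have h2 (i j : ℤ) : (-1 : ℝ) ^ (i + j + 1) * (-1 : ℝ) ^ (i - j) = -1 := by
    rw [← zpow_add₀ (by norm_num)]
    exact Odd.neg_one_zpow ⟨i, by ring⟩
  rw [sub_eq_add_neg, ← neg_mul, thetaP.eq_1 _ ((a + b + 1) / 2), ← tsum_neg]
  refine tsum_mul_tsum_parity (summable_thetaM hw _) (summable_thetaM hw _)
    (summable_thetaP hw2 _) (summable_thetaP hw2 _) (summable_thetaP hw2 _).neg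
    (summable_thetaP hw2 _) (fun i j => ?_) (fun i j => ?_)
  · rw [mul_mul_mul_comm, h1, one_mul, ← exp_add, ← exp_add]
    congr 1
    push_cast
    ring
  · rw [mul_mul_mul_comm, h2, neg_one_mul, neg_mul (exp _), ← exp_add, ← exp_add]
    congr 2
    push_cast
    ring

lemma thetaP_mul_thetaM {w : ℝ} (hw : 0 < w) (a b : ℝ) :
    thetaP w a * thetaM w b = thetaM (2 * w) ((a + b) / 2) * thetaM (2 * w) ((a - b) / 2) +
      thetaM (2 * w) ((a + b + 1) / 2) * thetaM (2 * w) ((a - b + 1) / 2) := by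
  have hw2 : 0 < 2 * w := by linarith
  have h1 (i j : ℤ) : (-1 : ℝ) ^ (i - j) = (-1) ^ i * (-1) ^ j := by
    rw [← zpow_add₀ (by norm_num), neg_one_zpow_eq_ite, neg_one_zpow_eq_ite]
    simp [Int.even_add, Int.even_sub]
  refine tsum_mul_tsum_parity (summable_thetaP hw _) (summable_thetaM hw _)
    (summable_thetaM hw2 _) (summable_thetaM hw2 _) (summable_thetaM hw2 _)
    (summable_thetaM hw2 _) (fun i j => ?_) (fun i j => ?_) <;>
  · rw [mul_mul_mul_comm, ← h1, mul_left_comm, ← exp_add, ← exp_add]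
    congr 2
    push_cast
    ring

lemma thetaP_add_one (w c : ℝ) : thetaP w (c + 1) = thetaP w c := by
  rw [thetaP, thetaP, ← (Equiv.addRight (1 : ℤ)).tsum_eq fun n : ℤ => exp (-w * ((n : ℝ) + c) ^ 2)]
  refine tsum_congr fun n => ?_
  simp only [Equiv.coe_addRight]
  push_cast
  ring_nf

lemma thetaP_neg (w c : ℝ) : thetaP w (-c) = thetaP w c := by
  rw [thetaP, thetaP, ← (Equiv.neg ℤ).tsum_eq fun n : ℤ => exp (-w * ((n : ℝ) + c) ^ 2)]
  refine tsum_congr fun n => ?_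
  simp only [Equiv.neg_apply]
  push_cast
  ring_nf

lemma thetaM_half (w : ℝ) : thetaM w (1 / 2) = 0 := by
  have h : thetaM w (1 / 2) = -thetaM w (1 / 2) := by
    conv_rhs => rw [thetaM, ← ((Equiv.neg ℤ).trans (Equiv.addRight (-1 : ℤ))).tsum_eq
      fun n : ℤ => (-1 : ℝ) ^ n * exp (-w * ((n : ℝ) + 1 / 2) ^ 2), ← tsum_neg]
    rw [thetaM]
    refine tsum_congr fun n => ?_
    simp only [Equiv.trans_apply, Equiv.neg_apply, Equiv.coe_addRight]
    rw [zpow_add₀ (by norm_num), zpow_neg_one, zpow_neg, ← inv_zpow]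
    push_cast
    rw [show (-(n : ℝ) + -1 + 1 / 2) ^ 2 = (n + 1 / 2) ^ 2 by ring]
    norm_num
  linarith

/-- Integers, split by parity. -/
def evenOddEquiv : ℤ ⊕ ℤ ≃ ℤ where
  toFun := Sum.elim (fun n => 2 * n) (fun n => 2 * n + 1)
  invFun n := if n % 2 = 0 then .inl (n / 2) else .inr ((n - 1) / 2)
  left_inv := by
    rintro (n | n)
    · simp
    · have h : ¬ (2 * n + 1) % 2 = 0 := by omega
      simp only [Sum.elim_inr, h, if_false, Sum.inr.injEq]
      omega
  right_inv n := by
    by_cases h : n % 2 = 0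
    · simp only [h, if_true, Sum.elim_inl]
      omega
    · simp only [h, if_false, Sum.elim_inr]
      omega

lemma tsum_eq_even_add_odd {f f₁ f₂ : ℤ → ℝ} (hf₁ : Summable f₁) (hf₂ : Summable f₂)
    (h₁ : ∀ n, f (2 * n) = f₁ n) (h₂ : ∀ n, f (2 * n + 1) = f₂ n) :
    ∑' n, f n = (∑' n, f₁ n) + ∑' n, f₂ n := by
  rw [← evenOddEquiv.tsum_eq, Summable.tsum_sum]
  · congr 1
    · exact tsum_congr h₁
    · exact tsum_congr h₂
  · exact hf₁.congr fun n => (h₁ n).symm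
  · exact hf₂.congr fun n => (h₂ n).symm

lemma thetaP_eq_add {w : ℝ} (hw : 0 < w) (c : ℝ) :
    thetaP w c = thetaP (4 * w) (c / 2) + thetaP (4 * w) ((c + 1) / 2) := by
  have hw4 : 0 < 4 * w := by linarith
  refine tsum_eq_even_add_odd (summable_thetaP hw4 _) (summable_thetaP hw4 _)
    (fun n => ?_) (fun n => ?_) <;>
  · congr 1
    push_cast
    ring

lemma thetaM_eq_sub {w : ℝ} (hw : 0 < w) (c : ℝ) :
    thetaM w c = thetaP (4 * w) (c / 2) - thetaP (4 * w) ((c + 1) / 2) := by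
  have hw4 : 0 < 4 * w := by linarith
  rw [sub_eq_add_neg, thetaP.eq_1 _ ((c + 1) / 2), ← tsum_neg]
  refine tsum_eq_even_add_odd (summable_thetaP hw4 _) (summable_thetaP hw4 _).neg
    (fun n => ?_) (fun n => ?_)
  · rw [Even.neg_one_zpow (even_two_mul n), one_mul]
    congr 1
    push_cast
    ring
  · rw [Odd.neg_one_zpow (odd_two_mul_add_one n), neg_one_mul]
    congr 2
    push_cast
    ring

lemma thetaP_half {w : ℝ} (hw : 0 < w) : thetaP w (1 / 2) = 2 * thetaP (4 * w) (1 / 4) := by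
  have h : thetaP (4 * w) (3 / 4) = thetaP (4 * w) (1 / 4) := by
    rw [← thetaP_add_one, ← thetaP_neg, ← thetaP_add_one, ← thetaP_add_one]
    norm_num
  rw [thetaP_eq_add hw]
  norm_num
  rw [h]
  ring

lemma thetaP_zero_sq {w : ℝ} (hw : 0 < w) :
    thetaP w 0 ^ 2 = thetaP (2 * w) 0 ^ 2 + thetaP (2 * w) (1 / 2) ^ 2 := by
  rw [sq, thetaP_mul_thetaP hw]
  norm_num
  ring

lemma thetaM_zero_sq {w : ℝ} (hw : 0 < w) :
    thetaM w 0 ^ 2 = thetaP (2 * w) 0 ^ 2 - thetaP (2 * w) (1 / 2) ^ 2 := by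
  rw [sq, thetaM_mul_thetaM hw]
  norm_num
  ring

lemma thetaP_zero_mul_thetaM_zero {w : ℝ} (hw : 0 < w) :
    thetaP w 0 * thetaM w 0 = thetaM (2 * w) 0 ^ 2 := by
  rw [thetaP_mul_thetaM hw]
  norm_num
  rw [thetaM_half]
  ring

lemma thetaP_half_sq {w : ℝ} (hw : 0 < w) :
    thetaP w (1 / 2) ^ 2 = 2 * thetaP (2 * w) 0 * thetaP (2 * w) (1 / 2) := by
  rw [sq, thetaP_mul_thetaP hw]
  norm_num
  rw [← zero_add (1 : ℝ), thetaP_add_one]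
  ring

lemma thetaP_pos {w : ℝ} (hw : 0 < w) (c : ℝ) : 0 < thetaP w c :=
  (summable_thetaP hw c).tsum_pos (fun _ => (exp_pos _).le) 0 (exp_pos _)

lemma thetaM_quarter_sq {w : ℝ} (hw : 0 < w) :
    thetaM w (1 / 4) ^ 2 = thetaP (w / 2) (1 / 2) * thetaM (w / 2) 0 / 2 := by
  have h : thetaP (2 * w) (3 / 4) = thetaP (2 * w) (1 / 4) := by
    rw [← thetaP_add_one, ← thetaP_neg, ← thetaP_add_one, ← thetaP_add_one]
    norm_num
  rw [sq, thetaM_mul_thetaM hw, thetaP_half (half_pos hw), thetaM_eq_sub (half_pos hw)]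
  rw [show 4 * (w / 2) = 2 * w by ring]
  norm_num
  rw [h]
  ring

lemma thetaM_eighths_mul {w : ℝ} (hw : 0 < w) :
    thetaM (2 * w) (1 / 8) * thetaM (2 * w) (3 / 8) =
      thetaP w (1 / 2) * thetaM w (1 / 4) / 2 := by
  have h : thetaP (4 * w) (3 / 4) = thetaP (4 * w) (1 / 4) := by
    rw [← thetaP_add_one, ← thetaP_neg, ← thetaP_add_one, ← thetaP_add_one]
    norm_num
  have h' : thetaP (4 * w) (5 / 8) = thetaP (4 * w) (3 / 8) := by
    rw [← thetaP_add_one, ← thetaP_neg, ← thetaP_add_one, ← thetaP_add_one]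
    norm_num
  have hw2 : 0 < 2 * w := by linarith
  rw [thetaM_mul_thetaM hw2, thetaP_half hw, thetaM_eq_sub hw, ← thetaP_neg _ ((1 / 8 - 3 / 8) / 2),
    show 2 * (2 * w) = 4 * w by ring]
  norm_num
  rw [h, h']
  ring

lemma thetaM_eighths_sq_sub_sq {w : ℝ} (hw : 0 < w) :
    thetaM (2 * w) (1 / 8) ^ 2 - thetaM (2 * w) (3 / 8) ^ 2 = thetaP w 0 * thetaM w (1 / 4) := by
  have h : thetaP (4 * w) (7 / 8) = thetaP (4 * w) (1 / 8) := by
    rw [← thetaP_add_one, ← thetaP_neg, ← thetaP_add_one, ← thetaP_add_one]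
    norm_num
  have h' : thetaP (4 * w) (5 / 8) = thetaP (4 * w) (3 / 8) := by
    rw [← thetaP_add_one, ← thetaP_neg, ← thetaP_add_one, ← thetaP_add_one]
    norm_num
  have hw2 : 0 < 2 * w := by linarith
  rw [sq, sq, thetaM_mul_thetaM hw2, thetaM_mul_thetaM hw2, thetaM_eq_sub hw, thetaP_eq_add hw,
    show 2 * (2 * w) = 4 * w by ring]
  norm_num
  rw [h, h']
  ring

lemma thetaP_inversion {y : ℝ} (hy : 0 < y) :
    thetaP (π / y) 0 = √y * thetaP (π * y) 0 := by
  have h := Real.tsum_exp_neg_mul_int_sq (inv_pos.2 hy)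
  rw [← sqrt_eq_rpow, sqrt_inv, one_div, inv_inv] at h
  simp only [thetaP, add_zero]
  convert h using 2
  · simp [div_eq_mul_inv]
  · simp [div_eq_mul_inv]

lemma thetaM_inversion {y : ℝ} (hy : 0 < y) :
    thetaM (π / y) 0 = √y * thetaP (π * y) (1 / 2) := by
  have hre : 0 < ((y⁻¹ : ℝ) : ℂ).re := by simpa using hy
  have h := Complex.tsum_exp_neg_quadratic hre (Complex.I / 2)
  have h1 : (((y⁻¹ : ℝ) : ℂ)) ^ (1 / 2 : ℂ) = ((√y)⁻¹ : ℝ) := by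
    rw [← sqrt_inv, sqrt_eq_rpow, Complex.ofReal_cpow (inv_pos.2 hy).le]
    norm_num
  have h2 (n : ℤ) : Complex.exp (-π * ((y⁻¹ : ℝ) : ℂ) * n ^ 2 + 2 * π * (Complex.I / 2) * n) =
      (((-1 : ℝ) ^ n * exp (-(π / y) * ((n : ℝ) + 0) ^ 2) : ℝ) : ℂ) := by
    rw [Complex.exp_add, show 2 * π * (Complex.I / 2) * (n : ℂ) = n * (π * Complex.I) by ring,
      Complex.exp_int_mul, Complex.exp_pi_mul_I, mul_comm]
    push_cast
    rw [add_zero, div_eq_mul_inv]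
    ring_nf
  have h3 (n : ℤ) : Complex.exp (-π / ((y⁻¹ : ℝ) : ℂ) * (n + Complex.I * (Complex.I / 2)) ^ 2) =
      ((exp (-(π * y) * ((n : ℝ) + -(1 / 2)) ^ 2) : ℝ) : ℂ) := by
    rw [show Complex.I * (Complex.I / 2) = -(1 / 2) by
      rw [← mul_div_assoc, Complex.I_mul_I]; ring]
    push_cast
    rw [div_inv_eq_mul]
    ring_nf
  simp_rw [h1, h2, h3] at h
  rw [← Complex.ofReal_tsum, ← Complex.ofReal_tsum] at h
  rw [← thetaP_neg (π * y), thetaM, thetaP]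
  have h' := h
  rw [one_div, ← Complex.ofReal_inv, inv_inv, ← Complex.ofReal_mul] at h'
  exact_mod_cast h'

lemma thetaM_zero_pos {w : ℝ} (hw : 0 < w) : 0 < thetaM w 0 := by
  have h := thetaM_inversion (div_pos pi_pos hw)
  rw [div_div_cancel₀ pi_ne_zero] at h
  rw [h]
  exact mul_pos (sqrt_pos.2 (div_pos pi_pos hw)) (thetaP_pos (by positivity) _)

lemma thetaM_zero_le_thetaP_zero {w : ℝ} (hw : 0 < w) : thetaM w 0 ≤ thetaP w 0 := by
  refine (summable_thetaM hw 0).tsum_le_tsum (fun n => ?_) (summable_thetaP hw 0)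
  have h : (-1 : ℝ) ^ n ≤ 1 := by
    rcases Int.even_or_odd n with h | h <;> simp [h.neg_one_zpow]
  nlinarith [exp_pos (-w * ((n : ℝ) + 0) ^ 2)]

/-- Complete elliptic integral in Gauss's homogeneous form. -/
noncomputable def gaussI (a b : ℝ) : ℝ :=
  ∫ θ in (0 : ℝ)..(π / 2), (√(a ^ 2 * cos θ ^ 2 + b ^ 2 * sin θ ^ 2))⁻¹

lemma gauss_radicand_pos {a b : ℝ} (ha : 0 < a) (hb : 0 < b) (θ : ℝ) :
    0 < a ^ 2 * cos θ ^ 2 + b ^ 2 * sin θ ^ 2 := by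
  have h := sin_sq_add_cos_sq θ
  rcases eq_or_ne (sin θ) 0 with h0 | h0
  · rw [h0] at h ⊢
    have : cos θ ^ 2 = 1 := by linarith
    rw [this]
    positivity
  · positivity

lemma continuous_gauss_integrand {a b : ℝ} (ha : 0 < a) (hb : 0 < b) :
    Continuous fun θ => (√(a ^ 2 * cos θ ^ 2 + b ^ 2 * sin θ ^ 2))⁻¹ := by
  refine Continuous.inv₀ (by fun_prop) fun θ => ?_
  exact (sqrt_pos.2 (gauss_radicand_pos ha hb θ)).ne'

lemma gaussI_mul {c : ℝ} (hc : 0 < c) (a b : ℝ) : gaussI (c * a) (c * b) = c⁻¹ * gaussI a b := by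
  rw [gaussI, gaussI, ← intervalIntegral.integral_const_mul]
  congr 1
  ext θ
  rw [show (c * a) ^ 2 * cos θ ^ 2 + (c * b) ^ 2 * sin θ ^ 2 =
    c ^ 2 * (a ^ 2 * cos θ ^ 2 + b ^ 2 * sin θ ^ 2) by ring, sqrt_mul (sq_nonneg c),
    sqrt_sq hc.le, mul_inv]

lemma gaussI_zero_pi {a b : ℝ} (ha : 0 < a) (hb : 0 < b) :
    ∫ θ in (0 : ℝ)..π, (√(a ^ 2 * cos θ ^ 2 + b ^ 2 * sin θ ^ 2))⁻¹ = 2 * gaussI a b := by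
  have hc := continuous_gauss_integrand ha hb
  have h := intervalIntegral.integral_comp_sub_left
    (fun θ => (√(a ^ 2 * cos θ ^ 2 + b ^ 2 * sin θ ^ 2))⁻¹) (a := 0) (b := π / 2) π
  rw [sub_zero, show π - π / 2 = π / 2 by ring] at h
  simp only [cos_pi_sub, sin_pi_sub, neg_sq] at h
  rw [← intervalIntegral.integral_add_adjacent_intervals (hc.intervalIntegrable 0 (π / 2))
    (hc.intervalIntegrable (π / 2) π), ← h, gaussI]
  ring

lemma gaussI_le {a b : ℝ} (hb : 0 < b) (hab : b ≤ a) :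
    gaussI a b ≤ π / 2 * b⁻¹ ∧ π / 2 * a⁻¹ ≤ gaussI a b := by
  have ha : 0 < a := hb.trans_le hab
  have hpi : (0 : ℝ) ≤ π / 2 := by positivity
  have hc := (continuous_gauss_integrand ha hb).intervalIntegrable (μ := MeasureTheory.volume)
    0 (π / 2)
  constructor
  · have h := intervalIntegral.integral_mono_on (μ := MeasureTheory.volume) hpi hc
      (intervalIntegrable_const (c := b⁻¹)) (fun θ _ => by
        apply inv_anti₀ hb
        apply le_sqrt_of_sq_le
        nlinarith [sin_sq_add_cos_sq θ, sq_nonneg (cos θ), mul_self_le_mul_self hb.le hab])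
    simpa [gaussI] using h
  · have h := intervalIntegral.integral_mono_on (μ := MeasureTheory.volume) hpi
      (intervalIntegrable_const (c := a⁻¹)) hc (fun θ _ => by
        apply inv_anti₀ (sqrt_pos.2 (gauss_radicand_pos ha hb θ))
        rw [sqrt_le_left ha.le]
        nlinarith [sin_sq_add_cos_sq θ, sq_nonneg (sin θ), mul_self_le_mul_self hb.le hab])
    simpa [gaussI] using h

lemma gaussI_agm {a b : ℝ} (ha : 0 < a) (hb : 0 < b) :
    gaussI ((a + b) / 2) (√(a * b)) = gaussI a b := by
  have ha1 : 0 < (a + b) / 2 := by positivity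
  have hb1 : 0 < √(a * b) := by positivity
  set D : ℝ → ℝ := fun θ => a * cos θ ^ 2 + b * sin θ ^ 2 with hD
  set R : ℝ → ℝ := fun θ => a ^ 2 * cos θ ^ 2 + b ^ 2 * sin θ ^ 2 with hR
  have hDpos (θ : ℝ) : 0 < D θ := by
    have := gauss_radicand_pos (sqrt_pos.2 ha) (sqrt_pos.2 hb) θ
    rwa [sq_sqrt ha.le, sq_sqrt hb.le] at this
  have hRpos (θ : ℝ) : 0 < R θ := gauss_radicand_pos ha hb θ
  set A : ℝ → ℝ := fun θ => (a - b) * (sin θ * cos θ) / D θ with hA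
  set φ : ℝ → ℝ := fun θ => 2 * θ - arctan (A θ) with hφ
  have hAsq (θ : ℝ) : 1 + A θ ^ 2 = R θ / D θ ^ 2 := by
    have h := sin_sq_add_cos_sq θ
    have h0 := (hDpos θ).ne'
    simp only [hA]
    rw [div_pow, eq_div_iff (by positivity), add_mul, div_mul_cancel₀ _ (by positivity)]
    simp only [hD, hR]
    rw [cos_sq']
    rw [mul_pow, mul_pow, cos_sq']
    ring
  have hAderiv (θ : ℝ) : HasDerivAt A
      ((a - b) * (a * cos θ ^ 2 - b * sin θ ^ 2) / D θ ^ 2) θ := by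
    have hD' : HasDerivAt D (a * (2 * cos θ * -sin θ) + b * (2 * sin θ * cos θ)) θ := by
      have h1 := ((hasDerivAt_cos θ).pow 2).const_mul a
      have h2 := ((hasDerivAt_sin θ).pow 2).const_mul b
      simpa using! h1.add h2
    have h := ((((hasDerivAt_sin θ).mul (hasDerivAt_cos θ)).const_mul (a - b)).div hD'
      (hDpos θ).ne')
    refine h.congr_deriv ?_
    congr 1
    simp only [hD, Pi.mul_apply]
    linear_combination ((a - b) * (a * cos θ ^ 2 - b * sin θ ^ 2)) * (sin_sq_add_cos_sq θ)
  have hφderiv (θ : ℝ) : HasDerivAt φ ((a + b) * D θ / R θ) θ := by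
    have h := ((hasDerivAt_id θ).const_mul 2).sub (hAderiv θ).arctan
    refine h.congr_deriv ?_
    have h0 := (hDpos θ).ne'
    have h1 := (hRpos θ).ne'
    rw [hAsq]
    field_simp
    simp only [hD, hR]
    ring
  have hcosarc (θ : ℝ) : cos (arctan (A θ)) = D θ / √(R θ) := by
    rw [cos_arctan, hAsq, sqrt_div (hRpos θ).le, sqrt_sq (hDpos θ).le, one_div_div]
  have hsinarc (θ : ℝ) : sin (arctan (A θ)) = (a - b) * (sin θ * cos θ) / √(R θ) := by
    have h0 := (hDpos θ).ne'
    rw [sin_arctan, hAsq, sqrt_div (hRpos θ).le, sqrt_sq (hDpos θ).le]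
    simp only [hA]
    field_simp
  have hsinφ (θ : ℝ) : sin (φ θ) = (a + b) * (sin θ * cos θ) / √(R θ) := by
    simp only [hφ]
    rw [sin_sub, hcosarc, hsinarc, sin_two_mul, cos_two_mul', ← mul_div_assoc, ← mul_div_assoc,
      ← sub_div]
    congr 1
    simp only [hD]
    linear_combination ((a + b) * (sin θ * cos θ)) * (sin_sq_add_cos_sq θ)
  have hrad (θ : ℝ) : ((a + b) / 2) ^ 2 * cos (φ θ) ^ 2 + √(a * b) ^ 2 * sin (φ θ) ^ 2 =
      ((a + b) / 2 * D θ) ^ 2 / R θ := by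
    rw [cos_sq', hsinφ, sq_sqrt (mul_pos ha hb).le, div_pow _ (√(R θ)), sq_sqrt (hRpos θ).le]
    have h1 := (hRpos θ).ne'
    field_simp
    simp only [hR, hD]
    rw [cos_sq']
    ring
  have key := intervalIntegral.integral_comp_mul_deriv (a := 0) (b := π / 2)
    (g := fun x => (√(((a + b) / 2) ^ 2 * cos x ^ 2 + √(a * b) ^ 2 * sin x ^ 2))⁻¹)
    (fun θ _ => hφderiv θ) (by
      apply Continuous.continuousOn
      apply Continuous.div _ _ fun θ => (hRpos θ).ne'
      · simp only [hD]; fun_prop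
      · simp only [hR]; fun_prop) (continuous_gauss_integrand ha1 hb1)
  have hφ0 : φ 0 = 0 := by simp [hφ, hA]
  have hφ1 : φ (π / 2) = π := by
    simp only [hφ, hA, cos_pi_div_two, mul_zero, zero_div, arctan_zero, sub_zero]
    ring
  rw [hφ0, hφ1, gaussI_zero_pi ha1 hb1] at key
  have key2 : ∫ θ in (0 : ℝ)..(π / 2), (2 : ℝ) * (√(R θ))⁻¹ = 2 * gaussI a b :=
    intervalIntegral.integral_const_mul _ _
  have : 2 * gaussI ((a + b) / 2) (√(a * b)) = 2 * gaussI a b := by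
    rw [← key, ← key2]
    congr 1
    ext θ
    simp only [Function.comp]
    rw [hrad, sqrt_div (sq_nonneg _), sqrt_sq (mul_pos ha1 (hDpos θ)).le]
    have h0 := (hDpos θ).ne'
    have h2 := (sqrt_pos.2 (hRpos θ)).ne'
    have h3 := sq_sqrt (hRpos θ).le
    have h4 : a + b ≠ 0 := by positivity
    nth_rewrite 2 [← h3]
    field_simp
  linarith

lemma tendsto_theta_atTop (ε : ℤ → ℝ) (hε : ∀ n, |ε n| ≤ 1) (h0 : ε 0 = 1) :
    Filter.Tendsto (fun w : ℝ => ∑' n : ℤ, ε n * exp (-w * ((n : ℝ) + 0) ^ 2)) Filter.atTop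
      (nhds 1) := by
  have hsum : ∑' n : ℤ, (if n = 0 then (1 : ℝ) else 0) = 1 := by simp
  rw [← hsum]
  refine tendsto_tsum_of_dominated_convergence (summable_thetaP one_pos 0) (fun n => ?_) ?_
  · rcases eq_or_ne n 0 with rfl | hn
    · simp [h0]
    · have hn' : 0 < ((n : ℝ) + 0) ^ 2 := by
        have : (n : ℝ) ≠ 0 := by exact_mod_cast hn
        rw [add_zero]
        positivity
      have h := (tendsto_exp_atBot.comp
        (Filter.tendsto_neg_atTop_atBot.atBot_mul_const hn')).const_mul (ε n)
      rw [mul_zero] at h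
      rw [if_neg hn]
      exact h
  · filter_upwards [Filter.eventually_ge_atTop 1] with w hw n
    rw [norm_mul, norm_eq_abs, norm_of_nonneg (exp_pos _).le]
    refine (mul_le_of_le_one_left (exp_pos _).le (hε n)).trans (exp_le_exp.2 ?_)
    nlinarith [sq_nonneg ((n : ℝ) + 0)]

lemma tendsto_thetaP_atTop : Filter.Tendsto (fun w => thetaP w 0) Filter.atTop (nhds 1) := by
  simpa [thetaP] using tendsto_theta_atTop (fun _ => 1) (by simp) rfl

lemma tendsto_thetaM_atTop : Filter.Tendsto (fun w => thetaM w 0) Filter.atTop (nhds 1) := by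
  simpa [thetaM] using tendsto_theta_atTop (fun n => (-1) ^ n) (by simp) (zpow_zero _)

lemma gaussI_theta_two_mul {w : ℝ} (hw : 0 < w) :
    gaussI (thetaP (2 * w) 0 ^ 2) (thetaM (2 * w) 0 ^ 2) =
      gaussI (thetaP w 0 ^ 2) (thetaM w 0 ^ 2) := by
  have h3 := thetaP_pos hw 0
  have h4 := thetaM_zero_pos hw
  rw [← gaussI_agm (pow_pos h3 2) (pow_pos h4 2)]
  congr 1
  · rw [thetaP_zero_sq hw, thetaM_zero_sq hw]
    ring
  · rw [← thetaP_zero_mul_thetaM_zero hw, ← mul_pow, sqrt_sq (mul_pos h3 h4).le]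

lemma gaussI_theta {w : ℝ} (hw : 0 < w) :
    gaussI (thetaP w 0 ^ 2) (thetaM w 0 ^ 2) = π / 2 := by
  have hiter (n : ℕ) : gaussI (thetaP (2 ^ n * w) 0 ^ 2) (thetaM (2 ^ n * w) 0 ^ 2) =
      gaussI (thetaP w 0 ^ 2) (thetaM w 0 ^ 2) := by
    induction n with
    | zero => simp
    | succ n ih =>
      rw [show (2 : ℝ) ^ (n + 1) * w = 2 * (2 ^ n * w) by ring,
        gaussI_theta_two_mul (by positivity), ih]
  have hb (n : ℕ) := gaussI_le (pow_pos (thetaM_zero_pos (w := 2 ^ n * w) (by positivity)) 2)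
    (pow_le_pow_left₀ (thetaM_zero_pos (w := 2 ^ n * w) (by positivity)).le
      (thetaM_zero_le_thetaP_zero (by positivity)) 2)
  simp only [hiter] at hb
  have hlim : Filter.Tendsto (fun n : ℕ => (2 : ℝ) ^ n * w) Filter.atTop Filter.atTop :=
    (tendsto_pow_atTop_atTop_of_one_lt one_lt_two).atTop_mul_const hw
  have l3 := (((tendsto_thetaP_atTop.comp hlim).pow 2).inv₀ (by norm_num)).const_mul (π / 2)
  have l4 := (((tendsto_thetaM_atTop.comp hlim).pow 2).inv₀ (by norm_num)).const_mul (π / 2)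
  simp only [one_pow, inv_one, mul_one] at l3 l4
  exact le_antisymm (ge_of_tendsto l4 (Filter.Eventually.of_forall fun n => (hb n).1))
    (le_of_tendsto l3 (Filter.Eventually.of_forall fun n => (hb n).2))

lemma thetaP_zero_pow_four {w : ℝ} (hw : 0 < w) :
    thetaP w 0 ^ 4 = thetaM w 0 ^ 4 + thetaP w (1 / 2) ^ 4 := by
  have h1 := thetaP_zero_sq hw
  have h2 := thetaM_zero_sq hw
  have h3 := thetaP_half_sq hw
  calc thetaP w 0 ^ 4 = (thetaP w 0 ^ 2) ^ 2 := by ring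
    _ = (thetaM w 0 ^ 2) ^ 2 + (thetaP w (1 / 2) ^ 2) ^ 2 := by
      rw [h1, h2, h3]; ring
    _ = _ := by ring

lemma ellK_eq_gaussI {k : ℝ} (hk : k ^ 2 ≤ 1) : ellK k = gaussI 1 √(1 - k ^ 2) := by
  rw [ellK, gaussI]
  congr 1
  ext θ
  rw [sq_sqrt (by linarith), one_pow, one_mul, show cos θ ^ 2 + (1 - k ^ 2) * sin θ ^ 2 =
    1 - k ^ 2 * sin θ ^ 2 by rw [cos_sq']; ring, sqrt_eq_rpow, ← rpow_neg]
  · norm_num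
  · nlinarith [sin_sq_le_one θ, sq_nonneg (sin θ), sq_nonneg k]

lemma ellK_strictMonoOn {k l : ℝ} (hk : 0 ≤ k) (hkl : k < l) (hl : l < 1) : ellK k < ellK l := by
  have hk1 : 0 < 1 - k ^ 2 := by nlinarith
  have hl1 : 0 < 1 - l ^ 2 := by nlinarith
  rw [ellK_eq_gaussI (by linarith), ellK_eq_gaussI (by linarith)]
  have hck := continuous_gauss_integrand one_pos (sqrt_pos.2 hk1)
  have hcl := continuous_gauss_integrand one_pos (sqrt_pos.2 hl1)
  have hlt : k ^ 2 < l ^ 2 := by nlinarith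
  refine intervalIntegral.integral_lt_integral_of_continuousOn_of_le_of_exists_lt (by positivity)
    hck.continuousOn hcl.continuousOn (fun θ _ => ?_) ⟨π / 2, ⟨by positivity, le_rfl⟩, ?_⟩
  · refine inv_anti₀ (sqrt_pos.2 (gauss_radicand_pos one_pos (sqrt_pos.2 hl1) θ)) (sqrt_le_sqrt ?_)
    rw [sq_sqrt hk1.le, sq_sqrt hl1.le]
    nlinarith [sq_nonneg (sin θ)]
  · simp only [cos_pi_div_two, sin_pi_div_two, one_pow, mul_one, ne_eq, OfNat.ofNat_ne_zero,
      not_false_eq_true, zero_pow, mul_zero, zero_add]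
    rw [sqrt_sq (sqrt_nonneg _), sqrt_sq (sqrt_nonneg _)]
    exact inv_strictAnti₀ (sqrt_pos.2 hl1) (sqrt_lt_sqrt hl1.le (by linarith))

/-- The modulus attached to the nome `exp (-w)`. -/
noncomputable def thetaModulus (w : ℝ) : ℝ := (thetaP w (1 / 2) / thetaP w 0) ^ 2

lemma thetaModulus_pos {w : ℝ} (hw : 0 < w) : 0 < thetaModulus w :=
  pow_pos (div_pos (thetaP_pos hw _) (thetaP_pos hw _)) 2

lemma one_sub_thetaModulus_sq {w : ℝ} (hw : 0 < w) :
    1 - thetaModulus w ^ 2 = ((thetaM w 0 / thetaP w 0) ^ 2) ^ 2 := by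
  have h := (thetaP_pos hw 0).ne'
  have h4 := thetaP_zero_pow_four hw
  rw [thetaModulus]
  field_simp
  linear_combination h4

lemma thetaModulus_lt_one {w : ℝ} (hw : 0 < w) : thetaModulus w < 1 := by
  have h := one_sub_thetaModulus_sq hw
  have h1 : 0 < ((thetaM w 0 / thetaP w 0) ^ 2) ^ 2 :=
    pow_pos (pow_pos (div_pos (thetaM_zero_pos hw) (thetaP_pos hw _)) 2) 2
  nlinarith [thetaModulus_pos hw]

lemma ellK_thetaModulus {w : ℝ} (hw : 0 < w) :
    ellK (thetaModulus w) = π / 2 * thetaP w 0 ^ 2 := by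
  have h3 := thetaP_pos hw 0
  have h := one_sub_thetaModulus_sq hw
  have h0 := sq_nonneg ((thetaM w 0 / thetaP w 0) ^ 2)
  rw [ellK_eq_gaussI (by linarith), h, sqrt_sq (sq_nonneg _),
    ← gaussI_theta hw]
  have := gaussI_mul (pow_pos h3 2) 1 ((thetaM w 0 / thetaP w 0) ^ 2)
  rw [mul_one, div_pow, mul_div_cancel₀ _ (pow_pos h3 2).ne'] at this
  rw [this, div_pow]
  field_simp

lemma ellK_compl_thetaModulus {y : ℝ} (hy : 0 < y) :
    ellK √(1 - thetaModulus (π * y) ^ 2) = y * ellK (thetaModulus (π * y)) := by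
  have hw : 0 < π * y := by positivity
  have hw' : 0 < π / y := by positivity
  have h3 := thetaP_pos hw 0
  have hk := thetaModulus_pos hw
  have hk1 := thetaModulus_lt_one hw
  have hk2 : 0 < 1 - thetaModulus (π * y) ^ 2 := by nlinarith
  rw [ellK_thetaModulus hw, ellK_eq_gaussI (by rw [sq_sqrt hk2.le]; nlinarith), sq_sqrt hk2.le,
    sub_sub_cancel, sqrt_sq hk.le, thetaModulus]
  have h := gaussI_theta hw'
  rw [thetaP_inversion hy, thetaM_inversion hy, mul_pow, mul_pow, sq_sqrt hy.le,
    gaussI_mul hy] at h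
  have := gaussI_mul (pow_pos h3 2) 1 ((thetaP (π * y) (1 / 2) / thetaP (π * y) 0) ^ 2)
  rw [mul_one, div_pow, mul_div_cancel₀ _ (pow_pos h3 2).ne'] at this
  rw [this, ← mul_assoc, ← mul_inv, inv_mul_eq_div, div_eq_iff (by positivity)] at h
  rw [div_pow, h]
  ring

lemma eq_thetaModulus {y k : ℝ} (hy : 0 < y) (hk0 : 0 < k) (hk1 : k < 1)
    (hk : ellK √(1 - k ^ 2) = y * ellK k) : k = thetaModulus (π * y) := by
  have hw : 0 < π * y := by positivity
  have hm0 := thetaModulus_pos hw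
  have hm1 := thetaModulus_lt_one hw
  have hm := ellK_compl_thetaModulus hy
  have hlt1 (x : ℝ) (hx : 0 < x) : √(1 - x ^ 2) < 1 := by
    rw [sqrt_lt' one_pos]
    nlinarith
  rcases lt_trichotomy k (thetaModulus (π * y)) with h | h | h
  · have h1 := ellK_strictMonoOn hk0.le h hm1
    have h2 := ellK_strictMonoOn (sqrt_nonneg _)
      (sqrt_lt_sqrt (x := 1 - thetaModulus (π * y) ^ 2) (y := 1 - k ^ 2) (by nlinarith)
        (by nlinarith)) (hlt1 k hk0)
    nlinarith
  · exact h
  · have h1 := ellK_strictMonoOn hm0.le h hk1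
    have h2 := ellK_strictMonoOn (sqrt_nonneg _)
      (sqrt_lt_sqrt (x := 1 - k ^ 2) (y := 1 - thetaModulus (π * y) ^ 2) (by nlinarith)
        (by nlinarith)) (hlt1 _ hm0)
    nlinarith

open Filter Topology Finset in
lemma tendsto_sum_range_succ_one {a : ℕ → ℕ → ℝ} {ρ : ℕ → ℝ} (h0 : ∀ N, a N 0 = 1)
    (ha : ∀ N s, |a N s| ≤ ρ N ^ s) (hρ : Tendsto ρ atTop (𝓝 0)) (hρ0 : ∀ N, 0 ≤ ρ N) :
    Tendsto (fun N => ∑ s ∈ range (N + 1), a N s) atTop (𝓝 1) := by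
  have hlim : Tendsto (fun N => ρ N * (1 - ρ N)⁻¹) atTop (𝓝 0) := by
    simpa using hρ.mul ((tendsto_const_nhds.sub hρ).inv₀ (by norm_num : (1 : ℝ) - 0 ≠ 0))
  rw [tendsto_iff_norm_sub_tendsto_zero]
  refine squeeze_zero' (Eventually.of_forall fun _ => norm_nonneg _) ?_ hlim
  filter_upwards [hρ.eventually (gt_mem_nhds one_pos)] with N hN
  rw [sum_range_succ', h0, add_sub_cancel_right]
  calc ‖∑ s ∈ range N, a N (s + 1)‖ ≤ ∑ s ∈ range N, ρ N * ρ N ^ s :=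
        norm_sum_le_of_le _ fun s _ => by simpa [pow_succ'] using ha N (s + 1)
    _ = ρ N * ∑ s ∈ range N, ρ N ^ s := (mul_sum ..).symm
    _ ≤ ρ N * (1 - ρ N)⁻¹ := by
        gcongr
        · exact hρ0 N
        rw [← tsum_geometric_of_lt_one (hρ0 N) hN]
        exact (summable_geometric_of_lt_one (hρ0 N) hN).sum_le_tsum _
          fun i _ => pow_nonneg (hρ0 N) i

/-- Euler's product `∏ (1 - xⁿ)`, with integer powers. -/
noncomputable def eulerP (x : ℝ) : ℝ := ∏' n : ℕ, (1 - x ^ (n + 1))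

lemma etaP_eq_eulerP (x : ℝ) : etaP x = eulerP x := by
  simp only [etaP, eulerP]
  congr! 3 with n
  exact_mod_cast rpow_natCast x (n + 1)

section
variable {x : ℝ}

lemma summable_norm_neg_pow_succ (hx0 : 0 ≤ x) (hx1 : x < 1) :
    Summable fun n : ℕ => ‖-x ^ (n + 1)‖ := by
  simpa [abs_of_nonneg hx0] using
    (summable_nat_add_iff 1).2 (summable_geometric_of_lt_one hx0 hx1)

lemma tendsto_eulerP (hx0 : 0 ≤ x) (hx1 : x < 1) :
    Filter.Tendsto (fun N => ∏ n ∈ Finset.range N, (1 - x ^ (n + 1))) Filter.atTop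
      (nhds (eulerP x)) := by
  simpa [sub_eq_add_neg, eulerP] using
    (multipliable_one_add_of_summable (summable_norm_neg_pow_succ hx0 hx1)).hasProd.tendsto_prod_nat

lemma one_sub_pow_succ_pos (hx0 : 0 ≤ x) (hx1 : x < 1) (n : ℕ) : 0 < 1 - x ^ (n + 1) :=
  sub_pos.2 (pow_lt_one₀ hx0 hx1 n.succ_ne_zero)

lemma eulerP_pos (hx0 : 0 ≤ x) (hx1 : x < 1) : 0 < eulerP x := by
  refine lt_of_le_of_ne ?_ (Ne.symm ?_)
  · exact ge_of_tendsto' (tendsto_eulerP hx0 hx1)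
      fun N => Finset.prod_nonneg fun n _ => (one_sub_pow_succ_pos hx0 hx1 n).le
  · simpa [sub_eq_add_neg, eulerP] using
      tprod_one_add_ne_zero_of_summable (f := fun n => -x ^ (n + 1))
        (fun n => by simpa [sub_eq_add_neg] using (one_sub_pow_succ_pos hx0 hx1 n).ne')
        (summable_norm_neg_pow_succ hx0 hx1)

open Finset

/-- The partial products `∏ (1 - xⁿ) / (1 + xⁿ)`. -/
noncomputable def squareProd (x : ℝ) (N : ℕ) : ℝ :=
  ∏ k ∈ range N, (1 - x ^ (k + 1)) / (1 + x ^ (k + 1))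

/-- The coefficients of the finite form of Gauss's identity for squares. -/
noncomputable def squareCoeff (x : ℝ) (s : ℕ) : ℝ :=
  ∏ k ∈ range s, (1 + x ^ k) / (1 - x ^ (k + 1))

lemma squareCoeff_succ_mul (hx0 : 0 ≤ x) (hx1 : x < 1) (s : ℕ) :
    squareCoeff x (s + 1) * (1 - x ^ (s + 1)) = squareCoeff x s * (1 + x ^ s) := by
  have := (one_sub_pow_succ_pos hx0 hx1 s).ne'
  rw [squareCoeff, prod_range_succ, ← squareCoeff]
  field_simp

lemma squareProd_succ_mul (hx0 : 0 ≤ x) (N : ℕ) :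
    squareProd x (N + 1) * (1 + x ^ (N + 1)) = squareProd x N * (1 - x ^ (N + 1)) := by
  have : 1 + x ^ (N + 1) ≠ 0 := by positivity
  rw [squareProd, prod_range_succ, ← squareProd]
  field_simp

lemma squareProd_mul_squareCoeff (hx0 : 0 ≤ x) (hx1 : x < 1) (N : ℕ) :
    squareProd x N * squareCoeff x N * (1 + x ^ N) = 2 := by
  induction N with
  | zero => simp [squareProd, squareCoeff]; norm_num
  | succ N ih =>
    have h₁ := squareCoeff_succ_mul hx0 hx1 N
    have h₂ := squareProd_succ_mul hx0 N
    linear_combination ih + squareCoeff x (N + 1) * h₂ + squareProd x N * h₁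

lemma sum_squareCoeff (hx0 : 0 ≤ x) (hx1 : x < 1) (y : ℝ) (M : ℕ) :
    ∑ s ∈ range M, (-1) ^ s * squareCoeff x s * y ^ s * (x ^ s * (1 - y) - (1 + y)) =
      (-1) ^ M * squareCoeff x M * (1 - x ^ M) * y ^ M := by
  induction M with
  | zero => simp
  | succ M ih =>
    rw [sum_range_succ, ih]
    linear_combination ((-1) ^ M * y ^ M * y) * squareCoeff_succ_mul hx0 hx1 M

lemma squareProd_mul_sum (hx0 : 0 ≤ x) (hx1 : x < 1) (N : ℕ) :
    squareProd x N * ∑ s ∈ range (N + 1), (-1) ^ s * squareCoeff x s * (x ^ (N + 1)) ^ s =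
      1 + 2 * ∑ j ∈ range N, (-1) ^ (j + 1) * x ^ (j + 1) ^ 2 := by
  induction N with
  | zero => simp [squareProd, squareCoeff]
  | succ N ih =>
    rw [sum_range_succ (fun j => (-1) ^ (j + 1) * x ^ (j + 1) ^ 2), mul_add, ← add_assoc, ← ih]
    have hxy : x ^ (N + 1) ^ 2 = (x ^ (N + 1)) ^ (N + 1) := by rw [← pow_mul, sq]
    have h₁ := sum_squareCoeff hx0 hx1 (x ^ (N + 1)) (N + 1)
    have h₂ := squareProd_succ_mul hx0 N
    have h₃ := squareProd_mul_squareCoeff hx0 hx1 (N + 1)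
    have e : ∀ s, (-1) ^ s * squareCoeff x s * (x ^ (N + 1 + 1)) ^ s =
        (-1) ^ s * squareCoeff x s * (x ^ (N + 1)) ^ s * x ^ s := fun s => by
      rw [pow_succ x (N + 1), mul_pow, mul_assoc _ _ (x ^ s)]
    simp only [mul_sub, sum_sub_distrib, ← mul_assoc, ← sum_mul] at h₁
    rw [sum_range_succ _ (N + 1)]
    simp only [e]
    rw [hxy]
    set y := x ^ (N + 1)
    have hy : 1 + y ≠ 0 := by positivity
    apply mul_right_cancel₀ hy
    set A := ∑ s ∈ range (N + 1), (-1) ^ s * squareCoeff x s * y ^ s * x ^ s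
    set B := ∑ s ∈ range (N + 1), (-1) ^ s * squareCoeff x s * y ^ s
    linear_combination squareProd x N * h₁ +
      (A + (-1) ^ (N + 1) * squareCoeff x (N + 1) * y ^ (N + 1) * y -
        (-1) ^ (N + 1) * squareCoeff x (N + 1) * y ^ (N + 1) * (1 + y)) * h₂ +
      (-1) ^ (N + 1) * y ^ (N + 1) * (1 + y) * h₃

lemma squareProd_mul_prod (hx0 : 0 ≤ x) (N : ℕ) :
    squareProd x N * ∏ k ∈ range N, (1 - (x ^ 2) ^ (k + 1)) =
      (∏ k ∈ range N, (1 - x ^ (k + 1))) ^ 2 := by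
  rw [squareProd, ← prod_mul_distrib, ← prod_pow]
  refine prod_congr rfl fun k _ => ?_
  have : 1 + x ^ (k + 1) ≠ 0 := by positivity
  field_simp
  ring

lemma abs_squareCoeff_le (hx0 : 0 ≤ x) (hx1 : x < 1) (s : ℕ) :
    |squareCoeff x s| ≤ (2 / (1 - x)) ^ s := by
  rw [squareCoeff, abs_prod, ← card_range s, ← prod_const, card_range]
  refine prod_le_prod (fun _ _ => abs_nonneg _) fun k _ => ?_
  have h := one_sub_pow_succ_pos hx0 hx1 k
  have h1 : 0 < 1 - x := sub_pos.2 hx1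
  rw [abs_of_nonneg (by positivity)]
  have h2 : x ^ (k + 1) ≤ x := pow_le_of_le_one hx0 hx1.le k.succ_ne_zero
  have h3 : x ^ k ≤ 1 := pow_le_one₀ hx0 hx1.le
  gcongr
  linarith

/-- Gauss's identity `1 + 2 ∑ (-1)ⁿ x^(n²) = ∏ (1 - xⁿ)² / (1 - x²ⁿ)`. -/
lemma tendsto_sum_neg_one_pow_mul_pow_sq (hx0 : 0 ≤ x) (hx1 : x < 1) :
    Filter.Tendsto (fun N => 1 + 2 * ∑ j ∈ range N, (-1) ^ (j + 1) * x ^ (j + 1) ^ 2)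
      Filter.atTop (nhds (eulerP x ^ 2 / eulerP (x ^ 2))) := by
  have hx2 : x ^ 2 < 1 := pow_lt_one₀ hx0 hx1 two_ne_zero
  have hx20 : 0 ≤ x ^ 2 := by positivity
  have h₁ : Filter.Tendsto (squareProd x) Filter.atTop (nhds (eulerP x ^ 2 / eulerP (x ^ 2))) := by
    refine (((tendsto_eulerP hx0 hx1).pow 2).div (tendsto_eulerP hx20 hx2)
      (eulerP_pos hx20 hx2).ne').congr fun N => ?_
    simp only [Pi.div_apply]
    rw [← squareProd_mul_prod hx0]
    exact mul_div_cancel_right₀ _ (prod_pos fun k _ => one_sub_pow_succ_pos hx20 hx2 k).ne'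
  have h1x : 0 < 1 - x := sub_pos.2 hx1
  have h₂ := h₁.mul (tendsto_sum_range_succ_one
    (a := fun N s => (-1) ^ s * squareCoeff x s * (x ^ (N + 1)) ^ s)
    (ρ := fun N => 2 / (1 - x) * x ^ (N + 1)) (fun N => by simp [squareCoeff]) (fun N s => ?_) ?_
    fun N => by positivity)
  · simpa only [squareProd_mul_sum hx0 hx1, mul_one] using h₂
  · have hxs : (0 : ℝ) ≤ (x ^ (N + 1)) ^ s := by positivity
    rw [mul_pow, abs_mul, abs_mul, abs_of_nonneg hxs]
    simpa using mul_le_mul_of_nonneg_right (abs_squareCoeff_le hx0 hx1 s) hxs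
  · simpa using ((tendsto_pow_atTop_nhds_zero_of_lt_one hx0 hx1).comp
      (Filter.tendsto_add_atTop_nat 1)).const_mul (2 / (1 - x))

/-- The partial products `∏ (1 - x²ⁿ) / (1 - x²ⁿ⁻¹)`. -/
noncomputable def triangleProd (x : ℝ) (N : ℕ) : ℝ :=
  ∏ k ∈ range N, (1 - x ^ (2 * k + 2)) / (1 - x ^ (2 * k + 1))

lemma triangleProd_pos (hx0 : 0 ≤ x) (hx1 : x < 1) (N : ℕ) : 0 < triangleProd x N :=
  prod_pos fun k _ => div_pos (one_sub_pow_succ_pos hx0 hx1 (2 * k + 1))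
    (one_sub_pow_succ_pos hx0 hx1 (2 * k))

lemma triangleProd_succ_mul (hx0 : 0 ≤ x) (hx1 : x < 1) (N : ℕ) :
    triangleProd x (N + 1) * (1 - x ^ (2 * N + 1)) = triangleProd x N * (1 - x ^ (2 * N + 2)) := by
  have := (one_sub_pow_succ_pos hx0 hx1 (2 * N)).ne'
  rw [triangleProd, prod_range_succ, ← triangleProd]
  field_simp

lemma one_le_triangleProd (hx0 : 0 ≤ x) (hx1 : x < 1) (N : ℕ) : 1 ≤ triangleProd x N := by
  induction N with
  | zero => simp [triangleProd]
  | succ N ih =>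
    rw [triangleProd, prod_range_succ, ← triangleProd]
    refine one_le_mul_of_one_le_of_one_le ih ?_
    rw [one_le_div (one_sub_pow_succ_pos hx0 hx1 (2 * N))]
    have : x ^ (2 * N + 2) ≤ x ^ (2 * N + 1) := pow_le_pow_of_le_one hx0 hx1.le (by omega)
    linarith

lemma inv_triangleProd_succ_mul (hx0 : 0 ≤ x) (hx1 : x < 1) (N : ℕ) :
    (triangleProd x (N + 1))⁻¹ * (1 - x ^ (2 * N + 2)) =
      (triangleProd x N)⁻¹ * (1 - x ^ (2 * N + 1)) := by
  have h₁ := (triangleProd_pos hx0 hx1 N).ne'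
  have h₂ := (triangleProd_pos hx0 hx1 (N + 1)).ne'
  field_simp
  linear_combination -triangleProd_succ_mul hx0 hx1 N

lemma sum_inv_triangleProd (hx0 : 0 ≤ x) (hx1 : x < 1) (z : ℝ) (M : ℕ) :
    ∑ s ∈ range M, (triangleProd x s)⁻¹ * z ^ s * (x ^ (2 * s) * (1 - x * z) - (1 - z)) =
      (triangleProd x M)⁻¹ * (1 - x ^ (2 * M)) * z ^ M := by
  induction M with
  | zero => simp
  | succ M ih =>
    rw [sum_range_succ, ih]
    linear_combination (-z ^ M * z) * inv_triangleProd_succ_mul hx0 hx1 M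

lemma triangleProd_mul_sum (hx0 : 0 ≤ x) (hx1 : x < 1) (N : ℕ) :
    triangleProd x N * ∑ s ∈ range N, (triangleProd x s)⁻¹ * (x ^ (2 * N + 1)) ^ s =
      ∑ n ∈ range (2 * N), x ^ (n * (n + 1) / 2) := by
  induction N with
  | zero => simp
  | succ N ih =>
    rw [show 2 * (N + 1) = 2 * N + 1 + 1 by ring, sum_range_succ _ (2 * N + 1),
      sum_range_succ _ (2 * N), ← ih]
    have e₁ : 2 * N * (2 * N + 1) / 2 = (2 * N + 1) * N := by
      rw [mul_assoc, Nat.mul_div_cancel_left _ two_pos, mul_comm]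
    have e₂ : (2 * N + 1) * (2 * N + 1 + 1) / 2 = (2 * N + 1) * N + (2 * N + 1) := by
      rw [show (2 * N + 1) * (2 * N + 1 + 1) = 2 * ((2 * N + 1) * N + (2 * N + 1)) by ring,
        Nat.mul_div_cancel_left _ two_pos]
    rw [e₁, e₂, pow_add x ((2 * N + 1) * N), pow_mul x (2 * N + 1) N]
    have h₁ := sum_inv_triangleProd hx0 hx1 (x ^ (2 * N + 1)) N
    have h₂ := triangleProd_succ_mul hx0 hx1 N
    have h₃ : triangleProd x N * (triangleProd x N)⁻¹ = 1 :=
      mul_inv_cancel₀ (triangleProd_pos hx0 hx1 N).ne'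
    have e : ∀ s, (triangleProd x s)⁻¹ * (x ^ (2 * N + 1 + 1 + 1)) ^ s =
        (triangleProd x s)⁻¹ * (x ^ (2 * N + 1)) ^ s * x ^ (2 * s) := fun s => by
      rw [show 2 * N + 1 + 1 + 1 = 2 * N + 1 + 2 by ring, pow_add x (2 * N + 1), mul_pow,
        ← pow_mul x 2, mul_assoc _ _ (x ^ (2 * s))]
    simp only [mul_sub, sum_sub_distrib, ← mul_assoc, ← sum_mul] at h₁
    simp only [e]
    rw [sum_range_succ]
    have hz : 1 - x ^ (2 * N + 1) ≠ 0 := (one_sub_pow_succ_pos hx0 hx1 (2 * N)).ne'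
    have hz2 : x ^ (2 * N + 2) = x * x ^ (2 * N + 1) := by ring
    have hz3 : x * x ^ (2 * N) = x ^ (2 * N + 1) := by ring
    rw [hz2] at h₂
    set z := x ^ (2 * N + 1)
    apply mul_right_cancel₀ hz
    set A := ∑ s ∈ range N, (triangleProd x s)⁻¹ * z ^ s * x ^ (2 * s)
    set B := ∑ s ∈ range N, (triangleProd x s)⁻¹ * z ^ s
    linear_combination triangleProd x N * h₁ +
      (A + (triangleProd x N)⁻¹ * z ^ N * x ^ (2 * N)) * h₂ +
      (z ^ N * (1 - z ^ 2)) * h₃ - triangleProd x N * (triangleProd x N)⁻¹ * z ^ N * z * hz3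

lemma triangleProd_mul_prod (hx0 : 0 ≤ x) (hx1 : x < 1) (N : ℕ) :
    triangleProd x N * ∏ k ∈ range (2 * N), (1 - x ^ (k + 1)) =
      (∏ k ∈ range N, (1 - (x ^ 2) ^ (k + 1))) ^ 2 := by
  induction N with
  | zero => simp [triangleProd]
  | succ N ih =>
    rw [show 2 * (N + 1) = 2 * N + 1 + 1 by ring, prod_range_succ _ (2 * N + 1),
      prod_range_succ _ (2 * N), prod_range_succ _ N, mul_pow, ← ih, ← pow_mul]
    have h₂ := triangleProd_succ_mul hx0 hx1 N
    linear_combination (∏ k ∈ range (2 * N), (1 - x ^ (k + 1))) * (1 - x ^ (2 * N + 2)) * h₂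

/-- Gauss's identity `∑ x^(n(n+1)/2) = ∏ (1 - x²ⁿ)² / (1 - xⁿ)`. -/
lemma tendsto_sum_pow_triangle (hx0 : 0 ≤ x) (hx1 : x < 1) :
    Filter.Tendsto (fun N => ∑ n ∈ range (2 * (N + 1)), x ^ (n * (n + 1) / 2))
      Filter.atTop (nhds (eulerP (x ^ 2) ^ 2 / eulerP x)) := by
  have hx2 : x ^ 2 < 1 := pow_lt_one₀ hx0 hx1 two_ne_zero
  have hx20 : 0 ≤ x ^ 2 := by positivity
  have h₁ : Filter.Tendsto (triangleProd x) Filter.atTop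
      (nhds (eulerP (x ^ 2) ^ 2 / eulerP x)) := by
    refine (((tendsto_eulerP hx20 hx2).pow 2).div ((tendsto_eulerP hx0 hx1).comp
      (Filter.tendsto_id.const_mul_atTop' two_pos)) (eulerP_pos hx0 hx1).ne').congr fun N => ?_
    simp only [Pi.div_apply, Function.comp, id]
    rw [← triangleProd_mul_prod hx0 hx1]
    exact mul_div_cancel_right₀ _ (prod_pos fun k _ => one_sub_pow_succ_pos hx0 hx1 k).ne'
  have h₂ := (h₁.comp (Filter.tendsto_add_atTop_nat 1)).mul (tendsto_sum_range_succ_one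
    (a := fun N s => (triangleProd x s)⁻¹ * (x ^ (2 * (N + 1) + 1)) ^ s)
    (ρ := fun N => x ^ (2 * (N + 1) + 1)) (fun N => by simp [triangleProd]) (fun N s => ?_) ?_
    fun N => by positivity)
  · simpa only [Function.comp, triangleProd_mul_sum hx0 hx1, mul_one] using h₂
  · have hxs : (0 : ℝ) ≤ (x ^ (2 * (N + 1) + 1)) ^ s := by positivity
    rw [abs_mul, abs_of_nonneg hxs, abs_of_pos (inv_pos.2 (triangleProd_pos hx0 hx1 s))]
    exact mul_le_of_le_one_left hxs (inv_le_one_of_one_le₀ (one_le_triangleProd hx0 hx1 s))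
  · exact (tendsto_pow_atTop_nhds_zero_of_lt_one hx0 hx1).comp
      (Filter.tendsto_atTop_mono (fun N => by dsimp; omega) Filter.tendsto_id)

end

lemma thetaM_zero_eq_eulerP {w : ℝ} (hw : 0 < w) :
    thetaM w 0 = eulerP (exp (-w)) ^ 2 / eulerP (exp (-w) ^ 2) := by
  have hx1 : exp (-w) < 1 := exp_lt_one_iff.2 (by linarith)
  have h := ((summable_thetaM hw 0).hasSum.nat_add_neg.tendsto_sum_nat.comp
    (Filter.tendsto_add_atTop_nat 1)).sub_const 1
  have h' := tendsto_nhds_unique (h.congr fun N => ?_)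
    (tendsto_sum_neg_one_pow_mul_pow_sq (exp_pos _).le hx1)
  · rw [← h', thetaM]
    norm_num
  · simp only [Function.comp]
    rw [Finset.sum_range_succ', Finset.mul_sum, add_sub_assoc, add_comm]
    congr 1
    · norm_num
    · refine Finset.sum_congr rfl fun n _ => ?_
      rw [zpow_neg, ← inv_zpow, inv_neg, inv_one, zpow_natCast, ← exp_nat_mul, two_mul]
      push_cast
      congr 3 <;> ring

lemma thetaP_half_eq_eulerP {w : ℝ} (hw : 0 < w) :
    thetaP w (1 / 2) =
      2 * exp (-w / 4) * (eulerP (exp (-(2 * w)) ^ 2) ^ 2 / eulerP (exp (-(2 * w)))) := by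
  have hx1 : exp (-(2 * w)) < 1 := exp_lt_one_iff.2 (by linarith)
  have h := (summable_thetaP hw (1 / 2)).hasSum.nat_add_neg_add_one.tendsto_sum_nat.comp
    (Filter.tendsto_atTop_mono (fun N => (by omega : N ≤ 2 * (N + 1))) Filter.tendsto_id)
  refine tendsto_nhds_unique h (((tendsto_sum_pow_triangle (exp_pos _).le hx1).const_mul
    (2 * exp (-w / 4))).congr fun N => ?_)
  rw [Finset.mul_sum]
  refine Finset.sum_congr rfl fun n _ => ?_
  have e : ((n * (n + 1) / 2 : ℕ) : ℝ) = n * (n + 1) / 2 := by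
    rw [Nat.cast_div (Nat.even_mul_succ_self n).two_dvd (by norm_num)]
    push_cast
    rfl
  rw [← exp_nat_mul, e, mul_assoc, ← exp_add, two_mul]
  push_cast
  congr 2 <;> ring

lemma exp_mul_eulerP_cube {w : ℝ} (hw : 0 < w) :
    2 * exp (-w / 2) * eulerP (exp (-w) ^ 4) ^ 3 =
      thetaP (2 * w) (1 / 2) * (thetaP (2 * w) 0 * thetaM (2 * w) 0) := by
  have hw2 : 0 < 2 * w := by positivity
  have hw4 : 0 < 2 * (2 * w) := by positivity
  have hx : exp (-w) ^ 4 = exp (-(2 * (2 * w))) := by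
    rw [← exp_nat_mul]
    congr 1
    push_cast
    ring
  have hx1 : exp (-(2 * (2 * w))) < 1 := exp_lt_one_iff.2 (by linarith)
  have h₁ := (eulerP_pos (exp_pos _).le hx1).ne'
  have h₂ := (eulerP_pos (sq_nonneg _) (pow_lt_one₀ (exp_pos _).le hx1 two_ne_zero)).ne'
  rw [thetaP_zero_mul_thetaM_zero hw2, thetaM_zero_eq_eulerP hw4, thetaP_half_eq_eulerP hw2, hx]
  rw [show -(2 * w) / 4 = -w / 2 by ring]
  generalize eulerP (exp (-(2 * (2 * w)))) = a at *
  generalize eulerP (exp (-(2 * (2 * w))) ^ 2) = b at *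
  field_simp

lemma continuousOn_tsum_neg_one_pow_mul_rpow {c x : ℝ} (hc : |c| ≤ 2)
    (hs : Summable fun n : ℤ => x ^ (2 * (n : ℝ) ^ 2 + c * n)) :
    ContinuousOn (fun y : ℝ => ∑' n : ℤ, (-1 : ℝ) ^ n * y ^ (2 * (n : ℝ) ^ 2 + c * n))
      (Set.Icc 0 x) := by
  have he : ∀ n : ℤ, 0 ≤ 2 * (n : ℝ) ^ 2 + c * n := fun n => by
    have h1 : |(n : ℝ)| ≤ (n : ℝ) ^ 2 := by
      rw [← sq_abs]
      have : (|n| : ℤ) ≤ |n| ^ 2 := Int.le_self_sq _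
      exact_mod_cast this
    have h2 : |c * n| ≤ 2 * |(n : ℝ)| := by
      rw [abs_mul]; gcongr
    linarith [neg_abs_le (c * n)]
  refine continuousOn_tsum (fun n => ?_) hs fun n y hy => ?_
  · exact continuousOn_const.mul (continuousOn_id.rpow_const fun y _ => Or.inr (he n))
  · rw [norm_mul, norm_zpow, norm_neg, norm_one, one_zpow, one_mul,
      Real.norm_of_nonneg (rpow_nonneg hy.1 _)]
    exact rpow_le_rpow hy.1 hy.2 (he n)

lemma tsum_neg_one_pow_mul_rpow_zero {c : ℝ} (hc : |c| < 2) :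
    ∑' n : ℤ, (-1 : ℝ) ^ n * (0 : ℝ) ^ (2 * (n : ℝ) ^ 2 + c * n) = 1 := by
  rw [tsum_eq_single 0]
  · simp
  · intro n hn
    rw [zero_rpow, mul_zero]
    have : 2 * (n : ℝ) ^ 2 + c * n = n * (2 * n + c) := by ring
    rw [this]
    refine mul_ne_zero (by exact_mod_cast hn) fun h => ?_
    have h1 : (1 : ℝ) ≤ |(n : ℝ)| := by exact_mod_cast Int.one_le_abs hn
    have h2 : c = -2 * n := by linarith
    rw [h2, abs_mul] at hc
    norm_num at hc
    linarith

lemma exp_mul_tsum_eq_thetaM (w c : ℝ) :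
    exp (-w * (2 * c ^ 2)) * ∑' n : ℤ, (-1 : ℝ) ^ n * exp (-w) ^ (2 * (n : ℝ) ^ 2 + 4 * c * n) =
      thetaM (2 * w) c := by
  rw [thetaM, ← tsum_mul_left]
  refine tsum_congr fun n => ?_
  rw [← exp_mul, mul_left_comm, ← exp_add]
  congr 2
  ring

lemma thetaM_pos_of_ne_zero {c : ℝ} (hc : |4 * c| < 2)
    (h : ∀ w, 0 < w → thetaM (2 * w) c ≠ 0) {w : ℝ} (hw : 0 < w) : 0 < thetaM (2 * w) c := by
  have hx1 : exp (-w) < 1 := exp_lt_one_iff.2 (by linarith)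
  have hs : Summable fun n : ℤ => exp (-w) ^ (2 * (n : ℝ) ^ 2 + 4 * c * n) := by
    have h2w : 0 < 2 * w := by positivity
    refine ((summable_thetaP h2w c).mul_left (exp (w * (2 * c ^ 2)))).congr fun n => ?_
    rw [← exp_mul, ← exp_add]
    congr 1
    ring
  have hcont := continuousOn_tsum_neg_one_pow_mul_rpow hc.le hs
  rw [← exp_mul_tsum_eq_thetaM]
  refine mul_pos (exp_pos _) ?_
  by_contra! hneg
  obtain ⟨y, hy, hy0⟩ := intermediate_value_Icc' (exp_pos (-w)).le hcont
    (show (0 : ℝ) ∈ Set.Icc _ _ from ⟨hneg, by simp [tsum_neg_one_pow_mul_rpow_zero hc]⟩)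
  dsimp only at hy0
  rcases hy.1.eq_or_lt with rfl | hypos
  · rw [tsum_neg_one_pow_mul_rpow_zero hc] at hy0
    exact one_ne_zero hy0
  · have hlog : 0 < -log y := neg_pos.2 (log_neg hypos (hy.2.trans_lt hx1))
    refine h _ hlog ?_
    rw [← exp_mul_tsum_eq_thetaM, neg_neg, exp_log hypos, hy0, mul_zero]

lemma thetaM_quarter_ne_zero {w : ℝ} (hw : 0 < w) : thetaM w (1 / 4) ≠ 0 := by
  have hw2 : 0 < w / 2 := by positivity
  have h := thetaM_quarter_sq hw
  intro h0
  have := mul_pos (thetaP_pos hw2 (1 / 2)) (thetaM_zero_pos hw2)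
  rw [h0] at h
  linarith

lemma thetaM_eighths_ne_zero {w : ℝ} (hw : 0 < w) :
    thetaM (2 * w) (1 / 8) ≠ 0 ∧ thetaM (2 * w) (3 / 8) ≠ 0 := by
  rw [← mul_ne_zero_iff, thetaM_eighths_mul hw]
  exact div_ne_zero (mul_ne_zero (thetaP_pos hw _).ne' (thetaM_quarter_ne_zero hw)) two_ne_zero

lemma thetaM_one_eighth_pos {w : ℝ} (hw : 0 < w) : 0 < thetaM (2 * w) (1 / 8) :=
  thetaM_pos_of_ne_zero (by norm_num [abs_lt]) (fun _ h => (thetaM_eighths_ne_zero h).1) hw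

lemma thetaM_three_eighths_pos {w : ℝ} (hw : 0 < w) : 0 < thetaM (2 * w) (3 / 8) :=
  thetaM_pos_of_ne_zero (by norm_num [abs_lt]) (fun _ h => (thetaM_eighths_ne_zero h).2) hw

lemma thetaModulus_mul_ratio_sq {w : ℝ} (hw : 0 < w) :
    thetaModulus w * (thetaM (2 * w) (3 / 8) / thetaM (2 * w) (1 / 8)) ^ 2 =
      2 + thetaModulus w - 2 * √(1 + thetaModulus w) := by
  have hk := thetaModulus_pos hw
  have hs := thetaM_three_eighths_pos hw
  have hu := thetaM_one_eighth_pos hw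
  have h2 := thetaP_pos hw (1 / 2)
  have h3 := thetaP_pos hw 0
  have h₁ := thetaM_eighths_mul hw
  have h₂ := thetaM_eighths_sq_sub_sq hw
  have hD : 0 < thetaM w (1 / 4) := by
    have : 0 < thetaP w (1 / 2) * thetaM w (1 / 4) := by nlinarith [mul_pos hu hs]
    exact (pos_iff_pos_of_mul_pos this).1 h2
  have hkt : thetaModulus w * thetaP w 0 ^ 2 = thetaP w (1 / 2) ^ 2 := by
    rw [thetaModulus]
    field_simp
  have he := sq_sqrt (show 0 ≤ 1 + thetaModulus w by positivity)
  have he0 := sqrt_nonneg (1 + thetaModulus w)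
  set s := thetaM (2 * w) (3 / 8)
  set u := thetaM (2 * w) (1 / 8)
  set D := thetaM w (1 / 4)
  set k := thetaModulus w
  set e := √(1 + k)
  set v := s / u with hv
  have hvu : s = v * u := by rw [hv]; field_simp
  rw [hvu] at h₁ h₂
  have hv1 : v ^ 2 < 1 := by
    have : 0 < u ^ 2 * (1 - v ^ 2) := by nlinarith [mul_pos h3 hD]
    linarith [(pos_iff_pos_of_mul_pos this).1 (by positivity)]
  have hquad : thetaP w (1 / 2) * (1 - v ^ 2) = 2 * thetaP w 0 * v := by
    apply mul_left_cancel₀ (mul_pos (pow_pos hu 2) hD).ne'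
    linear_combination thetaP w (1 / 2) * D * h₂ - 2 * thetaP w 0 * D * h₁
  have hk2 : k * (1 - v ^ 2) ^ 2 = 4 * v ^ 2 := by
    apply mul_left_cancel₀ (pow_pos h3 2).ne'
    linear_combination (1 - v ^ 2) ^ 2 * hkt +
      (thetaP w (1 / 2) * (1 - v ^ 2) + 2 * thetaP w 0 * v) * hquad
  have hfac : (k * v ^ 2 - k - 2 - 2 * e) * (k * v ^ 2 - k - 2 + 2 * e) = 0 := by
    linear_combination k * hk2 - 4 * he
  rcases mul_eq_zero.1 hfac with h | h
  · nlinarith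
  · linarith

lemma thetaM_three_eighths_pow {w : ℝ} (hw : 0 < w) :
    thetaM (2 * w) (3 / 8) ^ 48 = exp (-w) ^ 8 * eulerP (exp (-w) ^ 4) ^ 48 *
      (4 * (1 - thetaModulus w) ^ 4 * (2 + thetaModulus w - 2 * √(1 + thetaModulus w)) ^ 12 /
        (thetaModulus w ^ 13 * (1 + thetaModulus w) ^ 2)) := by
  have hw2 : 0 < w / 2 := by positivity
  have hu := thetaM_one_eighth_pos hw
  have h2 := thetaP_pos hw (1 / 2)
  have h3 := thetaP_pos hw 0
  have hP := thetaP_half_sq hw2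
  have hM := thetaM_zero_sq hw2
  rw [mul_div_cancel₀ w two_ne_zero] at hP hM
  have hD : thetaM w (1 / 4) ^ 4 =
      thetaP w (1 / 2) * thetaP w 0 * (thetaP w 0 ^ 2 - thetaP w (1 / 2) ^ 2) / 2 := by
    rw [show 4 = 2 * 2 from rfl, pow_mul, thetaM_quarter_sq hw, div_pow, mul_pow, hP, hM]
    ring
  have hs : thetaM (2 * w) (3 / 8) ^ 48 =
      (thetaP w (1 / 2) * thetaM w (1 / 4) / 2) ^ 24 *
        ((thetaM (2 * w) (3 / 8) / thetaM (2 * w) (1 / 8)) ^ 2) ^ 12 := by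
    rw [← thetaM_eighths_mul hw]
    field_simp
  have hX := thetaModulus_mul_ratio_sq hw
  have hE : exp (-w) ^ 8 * eulerP (exp (-w) ^ 4) ^ 48 =
      thetaP w (1 / 2) ^ 32 * thetaP w 0 ^ 8 *
        (thetaP w 0 ^ 4 - thetaP w (1 / 2) ^ 4) ^ 2 / 2 ^ 32 := by
    have h₁ : exp (-w) = exp (-w / 2) ^ 2 := by
      rw [← exp_nat_mul]
      congr 1
      push_cast
      ring
    have h₂ : (2 * exp (-w / 2) * eulerP (exp (-w) ^ 4) ^ 3) ^ 2 =
        thetaP w (1 / 2) ^ 4 * (thetaP w 0 * thetaM w 0) / 4 := by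
      rw [exp_mul_eulerP_cube hw, thetaP_zero_mul_thetaM_zero hw]
      linear_combination (-(thetaP w (1 / 2) ^ 2 + 2 * thetaP (2 * w) 0 * thetaP (2 * w) (1 / 2)) *
        thetaM (2 * w) 0 ^ 2 / 4) * thetaP_half_sq hw
    have h₃ : thetaP w 0 ^ 4 - thetaP w (1 / 2) ^ 4 = thetaM w 0 ^ 4 := by
      rw [thetaP_zero_pow_four hw]
      ring
    rw [h₃]
    calc exp (-w) ^ 8 * eulerP (exp (-w) ^ 4) ^ 48
        = ((2 * exp (-w / 2) * eulerP (exp (-w) ^ 4) ^ 3) ^ 2) ^ 8 / 2 ^ 16 := by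
          rw [mul_pow, mul_pow, mul_pow, ← h₁]
          ring
      _ = _ := by
          rw [h₂]
          ring
  have hv : (thetaM (2 * w) (3 / 8) / thetaM (2 * w) (1 / 8)) ^ 2 =
      (2 + thetaModulus w - 2 * √(1 + thetaModulus w)) / thetaModulus w := by
    rw [← hX, mul_div_cancel_left₀ _ (thetaModulus_pos hw).ne']
  rw [hs, hv, hE]
  generalize 2 + thetaModulus w - 2 * √(1 + thetaModulus w) = X
  have hDp : (thetaP w (1 / 2) * thetaM w (1 / 4) / 2) ^ 24 =
      thetaP w (1 / 2) ^ 24 * (thetaM w (1 / 4) ^ 4) ^ 6 / 2 ^ 24 := by ring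
  rw [hDp, hD, thetaModulus]
  generalize thetaP w (1 / 2) = a at *
  generalize thetaP w 0 = b at *
  have hab : b ^ 2 + a ^ 2 ≠ 0 := by positivity
  rw [show b ^ 4 - a ^ 4 = (b ^ 2 - a ^ 2) * (b ^ 2 + a ^ 2) by ring]
  field_simp
  ring

theorem stmt7 (r : ℝ) (hr : 0 < r) (q : ℝ) (hq : q = Real.exp (-π * Real.sqrt r))
    (k : ℝ) (hk0 : 0 < k) (hk1 : k < 1)
    (hk : ellK (Real.sqrt (1 - k ^ 2)) = Real.sqrt r * ellK k) :
    ∑' n : ℤ, (-1 : ℝ) ^ n * q ^ (2 * (n : ℝ) ^ 2 + 3 * (n : ℝ) / 2) =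
      q ^ (-(11 : ℝ) / 96) * etaP (q ^ 4) *
        (4 * (1 - k) ^ 4 * (2 + k - 2 * Real.sqrt (1 + k)) ^ 12 /
          (k ^ 13 * (1 + k) ^ 2)) ^ ((1 : ℝ) / 48) := by
  have hy : 0 < √r := sqrt_pos.2 hr
  have hkw := eq_thetaModulus hy hk0 hk1 hk
  rw [neg_mul] at hq
  have hw : 0 < π * √r := mul_pos pi_pos hy
  have hpow := thetaM_three_eighths_pow hw
  have hpos := thetaM_three_eighths_pos hw
  rw [← exp_mul_tsum_eq_thetaM] at hpow hpos
  rw [← hkw] at hpow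
  generalize π * √r = w at hq hw hpow hpos
  rw [← hq] at hpow hpos
  have hq0 : 0 < q := hq ▸ exp_pos _
  have hq1 : q < 1 := hq ▸ exp_lt_one_iff.2 (by linarith)
  have hH := eulerP_pos (pow_nonneg hq0.le 4) (pow_lt_one₀ hq0.le hq1 four_ne_zero)
  rw [etaP_eq_eulerP]
  have hexp : exp (-w * (2 * (3 / 8) ^ 2)) = q ^ ((9 : ℝ) / 32) := by
    rw [hq, ← exp_mul]
    congr 1
    ring
  have hsum : ∀ n : ℤ, 2 * (n : ℝ) ^ 2 + 4 * (3 / 8) * n = 2 * (n : ℝ) ^ 2 + 3 * n / 2 :=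
    fun n => by ring
  simp only [hexp, hsum] at hpow hpos
  set S := ∑' n : ℤ, (-1 : ℝ) ^ n * q ^ (2 * (n : ℝ) ^ 2 + 3 * (n : ℝ) / 2)
  have hS : 0 < S := (pos_iff_pos_of_mul_pos hpos).1 (rpow_pos_of_pos hq0 _)
  have hY : 0 ≤ 4 * (1 - k) ^ 4 * (2 + k - 2 * √(1 + k)) ^ 12 / (k ^ 13 * (1 + k) ^ 2) := by
    positivity
  set Y := 4 * (1 - k) ^ 4 * (2 + k - 2 * √(1 + k)) ^ 12 / (k ^ 13 * (1 + k) ^ 2)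
  rw [← pow_left_inj₀ hS.le (by positivity) (by norm_num : 48 ≠ 0), mul_pow, mul_pow,
    ← rpow_mul_natCast hY, ← rpow_mul_natCast hq0.le]
  norm_num
  rw [mul_pow, ← rpow_mul_natCast hq0.le] at hpow
  norm_num at hpow
  have h : q ^ 8 = q ^ ((27 : ℝ) / 2) * q ^ (-((11 : ℝ) / 2)) := by
    rw [← rpow_add hq0, ← rpow_natCast]
    norm_num
  apply mul_left_cancel₀ (rpow_pos_of_pos hq0 ((27 : ℝ) / 2)).ne'
  rw [hpow, h]
  ring
end

section
/- Let r > 0, let k ∈ (0,1) satisfy K(√(1−k²)) = √r · K(k), and let l ∈ (0,1) satisfy K(√(1−l²)) = 2√r · K(l). Then l = (1 − √(1−k²)) / (1 + √(1−k²)). -/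
open Real

lemma one_sub_sq_mul_sin_sq_pos {x : ℝ} (hx0 : 0 ≤ x) (hx1 : x < 1) (θ : ℝ) :
    0 < 1 - x ^ 2 * Real.sin θ ^ 2 := by
  nlinarith [Real.sin_sq_le_one θ, sq_nonneg (Real.sin θ), sq_nonneg x]

lemma continuous_ellK_integrand {x : ℝ} (hx0 : 0 ≤ x) (hx1 : x < 1) :
    Continuous fun θ : ℝ => (1 - x ^ 2 * Real.sin θ ^ 2) ^ (-(1:ℝ)/2) :=
  Continuous.rpow_const (by fun_prop)
    fun θ => Or.inl (one_sub_sq_mul_sin_sq_pos hx0 hx1 θ).ne'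

lemma rpow_neg_one_div_two {y : ℝ} (hy : 0 ≤ y) : y ^ (-(1:ℝ)/2) = (√y)⁻¹ := by
  rw [neg_div, Real.rpow_neg hy, Real.sqrt_eq_rpow]

/-- `K` is strictly increasing on `[0, 1)`. -/
lemma ellK_lt_ellK {a b : ℝ} (ha : 0 ≤ a) (hab : a < b) (hb : b < 1) : ellK a < ellK b := by
  have hπ : (0:ℝ) < π / 2 := by positivity
  have hsq : a ^ 2 < b ^ 2 := by gcongr
  have hb0 : 0 ≤ b := ha.trans hab.le
  refine intervalIntegral.integral_lt_integral_of_continuousOn_of_le_of_exists_lt hπ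
    (continuous_ellK_integrand ha (hab.trans hb)).continuousOn
    (continuous_ellK_integrand hb0 hb).continuousOn (fun θ _ => ?_)
    ⟨π / 2, ⟨hπ.le, le_rfl⟩, ?_⟩
  · refine Real.rpow_le_rpow_of_nonpos (one_sub_sq_mul_sin_sq_pos hb0 hb θ) ?_ (by norm_num)
    gcongr
  · refine Real.rpow_lt_rpow_of_neg (one_sub_sq_mul_sin_sq_pos hb0 hb _) ?_ (by norm_num)
    simpa using hsq

/-- Gauss's substitution: `sin θ = (1 + x) sin φ / (1 + x sin² φ)`. -/
noncomputable def gaussAngle (x φ : ℝ) : ℝ :=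
  Real.arcsin ((1 + x) * Real.sin φ / (1 + x * Real.sin φ ^ 2))

lemma one_sub_gauss_sq {x : ℝ} (hx0 : 0 ≤ x) (φ : ℝ) :
    1 - ((1 + x) * Real.sin φ / (1 + x * Real.sin φ ^ 2)) ^ 2 =
      Real.cos φ ^ 2 * (1 - x ^ 2 * Real.sin φ ^ 2) / (1 + x * Real.sin φ ^ 2) ^ 2 := by
  have h : 0 < 1 + x * Real.sin φ ^ 2 := by positivity
  rw [Real.cos_sq']
  field_simp
  ring

lemma continuous_gaussAngle {x : ℝ} (hx0 : 0 ≤ x) : Continuous (gaussAngle x) := by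
  refine Real.continuous_arcsin.comp (Continuous.div (by fun_prop) (by fun_prop) fun φ => ?_)
  positivity

lemma hasDerivAt_gaussAngle {x φ : ℝ} (hx0 : 0 ≤ x) (hx1 : x < 1) (hφ : 0 < Real.cos φ) :
    HasDerivAt (gaussAngle x) ((1 + x) * (1 - x * Real.sin φ ^ 2) /
      ((1 + x * Real.sin φ ^ 2) * √(1 - x ^ 2 * Real.sin φ ^ 2))) φ := by
  have h : 0 < 1 + x * Real.sin φ ^ 2 := by positivity
  have hp := one_sub_sq_mul_sin_sq_pos hx0 hx1 φ
  have hpos : 0 < 1 - ((1 + x) * Real.sin φ / (1 + x * Real.sin φ ^ 2)) ^ 2 := by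
    rw [one_sub_gauss_sq hx0]
    positivity
  have hnum : HasDerivAt (fun φ => (1 + x) * Real.sin φ) ((1 + x) * Real.cos φ) φ :=
    (Real.hasDerivAt_sin φ).const_mul _
  have hden : HasDerivAt (fun φ => 1 + x * Real.sin φ ^ 2)
      (x * (2 * Real.sin φ * Real.cos φ)) φ := by
    simpa using (((Real.hasDerivAt_sin φ).pow 2).const_mul x).const_add 1
  have harc := (Real.hasDerivAt_arcsin (x := (1 + x) * Real.sin φ / (1 + x * Real.sin φ ^ 2))
    (fun h => by rw [h] at hpos; norm_num at hpos)
    (fun h => by rw [h] at hpos; norm_num at hpos)).comp φ (hnum.div hden h.ne')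
  refine harc.congr_deriv ?_
  have hs : 0 < √(1 - x ^ 2 * Real.sin φ ^ 2) := Real.sqrt_pos.2 hp
  rw [one_sub_gauss_sq hx0, Real.sqrt_div (by positivity), Real.sqrt_mul (by positivity),
    Real.sqrt_sq hφ.le, Real.sqrt_sq h.le]
  field_simp
  ring

/-- The ascending Landen transformation. -/
lemma ellK_landen {x : ℝ} (hx0 : 0 ≤ x) (hx1 : x < 1) :
    ellK (2 * √x / (1 + x)) = (1 + x) * ellK x := by
  set c := 2 * √x / (1 + x) with hc
  have hc2 : c ^ 2 = 4 * x / (1 + x) ^ 2 := by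
    rw [hc, div_pow, mul_pow, Real.sq_sqrt hx0]
    norm_num
  have hc0 : 0 ≤ c := by positivity
  have hc1 : c < 1 := by
    have : c ^ 2 < 1 := by
      rw [hc2, div_lt_one (by positivity)]
      nlinarith
    nlinarith
  have hsub := intervalIntegral.integral_comp_mul_deriv'' (a := 0) (b := π / 2)
    (f := gaussAngle x)
    (f' := fun φ => (1 + x) * (1 - x * Real.sin φ ^ 2) /
      ((1 + x * Real.sin φ ^ 2) * √(1 - x ^ 2 * Real.sin φ ^ 2)))
    (g := fun θ => (1 - c ^ 2 * Real.sin θ ^ 2) ^ (-(1:ℝ)/2))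
    (continuous_gaussAngle hx0).continuousOn
    (fun φ hφ => by
      rw [min_eq_left (by positivity), max_eq_right (by positivity)] at hφ
      exact (hasDerivAt_gaussAngle hx0 hx1
        (Real.cos_pos_of_mem_Ioo ⟨by linarith [hφ.1, Real.pi_pos], hφ.2⟩)).hasDerivWithinAt)
    (Continuous.continuousOn (Continuous.div (by fun_prop) (by fun_prop) fun φ => by
      have := Real.sqrt_pos.2 (one_sub_sq_mul_sin_sq_pos hx0 hx1 φ)
      positivity))
    (continuous_ellK_integrand hc0 hc1).continuousOn
  have h0 : gaussAngle x 0 = 0 := by simp [gaussAngle]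
  have h1 : gaussAngle x (π / 2) = π / 2 := by
    simp [gaussAngle, div_self (show 1 + x ≠ 0 by positivity)]
  rw [h0, h1] at hsub
  rw [ellK, ← hsub, ellK, ← intervalIntegral.integral_const_mul]
  refine intervalIntegral.integral_congr fun φ _ => ?_
  have h : 0 < 1 + x * Real.sin φ ^ 2 := by positivity
  have hp := one_sub_sq_mul_sin_sq_pos hx0 hx1 φ
  have hs : 0 < √(1 - x ^ 2 * Real.sin φ ^ 2) := Real.sqrt_pos.2 hp
  have hm : 0 < 1 - x * Real.sin φ ^ 2 := by
    nlinarith [Real.sin_sq_le_one φ, sq_nonneg (Real.sin φ)]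
  have hle : ((1 + x) * Real.sin φ / (1 + x * Real.sin φ ^ 2)) ^ 2 ≤ 1 := by
    rw [← sub_nonneg, one_sub_gauss_sq hx0]
    positivity
  have hsin : Real.sin (gaussAngle x φ) = (1 + x) * Real.sin φ / (1 + x * Real.sin φ ^ 2) :=
    Real.sin_arcsin (abs_le.1 ((sq_le_one_iff_abs_le_one _).1 hle)).1
      (abs_le.1 ((sq_le_one_iff_abs_le_one _).1 hle)).2
  have hmod : 1 - c ^ 2 * Real.sin (gaussAngle x φ) ^ 2 =
      ((1 - x * Real.sin φ ^ 2) / (1 + x * Real.sin φ ^ 2)) ^ 2 := by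
    rw [hsin, hc2]
    field_simp
    ring
  simp only [Function.comp_apply]
  rw [hmod, rpow_neg_one_div_two (by positivity), rpow_neg_one_div_two hp.le,
    Real.sqrt_sq (by positivity)]
  field_simp

/-- The condition `K(√(1 - l²)) = c K(l)` with `c > 0` determines `l ∈ (0, 1)`. -/
lemma le_of_ellK_compl_eq {c l m : ℝ} (hc : 0 < c) (hl1 : l < 1) (hm0 : 0 < m)
    (hl : ellK √(1 - l ^ 2) = c * ellK l) (hm : ellK √(1 - m ^ 2) = c * ellK m) : l ≤ m := by
  by_contra! hlt
  have hsq : m ^ 2 < l ^ 2 := by gcongr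
  have hcompl : √(1 - l ^ 2) < √(1 - m ^ 2) :=
    Real.sqrt_lt_sqrt (by nlinarith) (by linarith)
  have hlt_one : √(1 - m ^ 2) < 1 := by
    rw [Real.sqrt_lt' one_pos]
    nlinarith
  have h1 := ellK_lt_ellK (Real.sqrt_nonneg _) hcompl hlt_one
  have h2 := mul_lt_mul_of_pos_left (ellK_lt_ellK hm0.le hlt hl1) hc
  linarith

theorem stmt10 (r : ℝ) (hr : 0 < r)
    (k : ℝ) (hk0 : 0 < k) (hk1 : k < 1)
    (hk : ellK (Real.sqrt (1 - k ^ 2)) = Real.sqrt r * ellK k)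
    (l : ℝ) (hl0 : 0 < l) (hl1 : l < 1)
    (hl : ellK (Real.sqrt (1 - l ^ 2)) = 2 * Real.sqrt r * ellK l) :
    l = (1 - Real.sqrt (1 - k ^ 2)) / (1 + Real.sqrt (1 - k ^ 2)) := by
  have hsq : √(1 - k ^ 2) ^ 2 = 1 - k ^ 2 := Real.sq_sqrt (by nlinarith)
  have hk'0 : 0 < √(1 - k ^ 2) := Real.sqrt_pos.2 (by nlinarith)
  set k' := √(1 - k ^ 2)
  have hk'1 : k' < 1 := by nlinarith
  set m := (1 - k') / (1 + k') with hm
  have hm0 : 0 < m := div_pos (by linarith) (by linarith)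
  have hm1 : m < 1 := by
    rw [hm, div_lt_one (by linarith)]
    linarith
  have hm_add : 1 + m = 2 / (1 + k') := by
    rw [hm]
    field_simp
    ring
  have hm_compl : √(1 - m ^ 2) = 2 * √k' / (1 + k') := by
    rw [Real.sqrt_eq_iff_mul_self_eq_of_pos (by positivity), ← sq, div_pow, mul_pow,
      Real.sq_sqrt hk'0.le, hm]
    field_simp
    ring
  have hm_asc : 2 * √m / (1 + m) = k := by
    rw [← sq_eq_sq₀ (by positivity) hk0.le, div_pow, mul_pow, Real.sq_sqrt hm0.le, hm_add,
      show k ^ 2 = (1 - k') * (1 + k') by linarith, hm]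
    field_simp
  have hK : ellK k = (1 + m) * ellK m := by
    rw [← ellK_landen hm0.le hm1, hm_asc]
  have hmK : ellK √(1 - m ^ 2) = 2 * √r * ellK m := by
    rw [hm_compl, ellK_landen hk'0.le hk'1, hk, hK, hm_add]
    field_simp
  have hc : 0 < 2 * √r := by positivity
  exact le_antisymm (le_of_ellK_compl_eq hc hl1 hm0 hl hmK)
    (le_of_ellK_compl_eq hc hm1 hl0 hmK hl)
end
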